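/- arXiv:2201.12915 — 4 statements merged into one kernel-verified Lean document; each statement's English description precedes it below -/
import Mathlib

section
/- Under these hypotheses, the two ω-limit sets of the absorbing compact set coincide: ι(ω_Y(K)) = ω_X(ι(K)). -/
open Filter Topology

/-- The ω-limit set of `B ⊆ X` computed in `X`: points `z` approached (in the `X`-norm)
by `T (t n) (x n)` with `t n → ∞` and `x n ∈ B`. -/
def omegaLimitX {X : Type*} [NormedAddCommGroup X]
    (T : ℝ → X → X) (B : Set X) : Set X :=
  {z | ∃ (t : ℕ → ℝ) (x : ℕ → X), (∀ n, x n ∈ B) ∧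
    Tendsto t atTop atTop ∧
    Tendsto (fun n => T (t n) (x n)) atTop (𝓝 z)}

/-- The ω-limit set of `B ⊆ X` computed in `Y` (identified with its image under `ι`):
points `z ∈ Y` such that for some `t n → ∞` and `x n ∈ B`, each `T (t n) (x n)` lies in
the image of `ι` and the preimages converge to `z` in the `Y`-norm. -/
def omegaLimitY {X Y : Type*} [NormedAddCommGroup X] [NormedAddCommGroup Y]
    (T : ℝ → X → X) (ι : Y → X) (B : Set X) : Set Y :=
  {z | ∃ (t : ℕ → ℝ) (x : ℕ → X) (y : ℕ → Y), (∀ n, x n ∈ B) ∧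
    Tendsto t atTop atTop ∧
    (∀ n, ι (y n) = T (t n) (x n)) ∧
    Tendsto y atTop (𝓝 z)}

/-- Under the absorption hypotheses, the two ω-limit sets of the absorbing compact set
coincide: `ι(ω_Y(K)) = ω_X(ι(K))`. -/
theorem omegaLimitY_eq_omegaLimitX
    {X Y : Type*}
    [NormedAddCommGroup X] [InnerProductSpace ℝ X] [CompleteSpace X]
    [NormedAddCommGroup Y] [InnerProductSpace ℝ Y] [CompleteSpace Y]
    (T : ℝ → X → X)
    (hT0 : T 0 = id)
    (hTadd : ∀ s ≥ (0:ℝ), ∀ t ≥ (0:ℝ), T (t + s) = T t ∘ T s)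
    (hTcont : ∀ t ≥ (0:ℝ), Continuous (T t))
    (ι : Y →L[ℝ] X) (hι : Function.Injective ι)
    (K : Set Y) (hK : IsCompact K)
    (habs : ∀ B : Set X, Bornology.IsBounded B →
      ∃ tB > (0:ℝ), ∀ t > tB, T t '' B ⊆ (⇑ι) '' K) :
    (⇑ι) '' (omegaLimitY T (⇑ι) ((⇑ι) '' K)) = omegaLimitX T ((⇑ι) '' K) := by
  ext z
  constructor
  · rintro ⟨w, ⟨t, x, y, hx, ht, hy, hyw⟩, rfl⟩
    refine ⟨t, x, hx, ht, ?_⟩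
    simpa only [Function.comp_def, hy] using (ι.continuous.tendsto w).comp hyw
  · rintro ⟨t, x, hx, ht, hz⟩
    obtain ⟨tK, -, htK⟩ := habs (ι '' K) (hK.image ι.continuous).isBounded
    obtain ⟨N, hN⟩ := eventually_atTop.1 (ht.eventually_gt_atTop tK)
    choose y hyK hy using fun n =>
      htK (t (n + N)) (hN _ (Nat.le_add_left N n)) (Set.mem_image_of_mem _ (hx (n + N)))
    obtain ⟨w, -, φ, hφ, hw⟩ := hK.tendsto_subseq hyK
    have hshift : Tendsto (fun n => φ n + N) atTop atTop :=
      (tendsto_add_atTop_nat N).comp hφ.tendsto_atTop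
    refine ⟨w, ⟨fun n => t (φ n + N), fun n => x (φ n + N), y ∘ φ, fun n => hx _,
      ht.comp hshift, fun n => hy _, hw⟩, ?_⟩
    refine tendsto_nhds_unique ((ι.continuous.tendsto w).comp hw) ?_
    simpa only [Function.comp_def, hy] using hz.comp hshift
end

section
/- Under these hypotheses, the set A := ι(ω_Y(K)) ⊆ X is invariant under the semiflow: T(t)A = A for every t ≥ 0. -/
open Filter Topology

/-- If `T t` maps `B` into the image of a compact `K ⊆ Y` for all large `t`, then along any times
tending to infinity the evolved points of `B` subconverge to a point of the ω-limit set. -/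
theorem exists_subseq_tendsto_omegaLimitY {X Y : Type*} [NormedAddCommGroup X]
    [NormedAddCommGroup Y] {T : ℝ → X → X} {ι : Y → X} (hι : Continuous ι) {K : Set Y}
    (hK : IsCompact K) {B : Set X} (habs : ∀ᶠ t in atTop, T t '' B ⊆ ι '' K)
    {t : ℕ → ℝ} (ht : Tendsto t atTop atTop) {x : ℕ → X} (hx : ∀ n, x n ∈ B) :
    ∃ z ∈ omegaLimitY T ι B, ∃ φ : ℕ → ℕ, Tendsto φ atTop atTop ∧
      Tendsto (fun n => T (t (φ n)) (x (φ n))) atTop (𝓝 (ι z)) := by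
  obtain ⟨N, hN⟩ := eventually_atTop.1 (ht.eventually habs)
  have hmem (n : ℕ) : ∃ y ∈ K, ι y = T (t (n + N)) (x (n + N)) :=
    hN (n + N) (Nat.le_add_left N n) (Set.mem_image_of_mem _ (hx _))
  choose y hyK hy using hmem
  obtain ⟨z, -, φ, hφ, hz⟩ := hK.tendsto_subseq hyK
  have hφN : Tendsto (fun n => φ n + N) atTop atTop :=
    (tendsto_add_atTop_nat N).comp hφ.tendsto_atTop
  refine ⟨z, ⟨fun n => t (φ n + N), fun n => x (φ n + N), y ∘ φ, fun n => hx _,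
    ht.comp hφN, fun n => hy _, hz⟩, fun n => φ n + N, hφN, ?_⟩
  exact ((hι.tendsto z).comp hz).congr fun n => hy (φ n)

/-- Under the absorption hypotheses, the set `A := ι(ω_Y(K)) ⊆ X` is invariant under the
semiflow: `T(t)A = A` for every `t ≥ 0`. -/
theorem omegaLimitY_invariant
    {X Y : Type*}
    [NormedAddCommGroup X] [InnerProductSpace ℝ X] [CompleteSpace X]
    [NormedAddCommGroup Y] [InnerProductSpace ℝ Y] [CompleteSpace Y]
    (T : ℝ → X → X)
    (hT0 : T 0 = id)
    (hTadd : ∀ s ≥ (0:ℝ), ∀ t ≥ (0:ℝ), T (t + s) = T t ∘ T s)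
    (hTcont : ∀ t ≥ (0:ℝ), Continuous (T t))
    (ι : Y →L[ℝ] X) (hι : Function.Injective ι)
    (K : Set Y) (hK : IsCompact K)
    (habs : ∀ B : Set X, Bornology.IsBounded B →
      ∃ tB > (0:ℝ), ∀ t > tB, T t '' B ⊆ (⇑ι) '' K) :
    ∀ t ≥ (0:ℝ),
      T t '' ((⇑ι) '' (omegaLimitY T (⇑ι) ((⇑ι) '' K)))
        = (⇑ι) '' (omegaLimitY T (⇑ι) ((⇑ι) '' K)) := by
  obtain ⟨tB, -, htB⟩ := habs _ (hK.image ι.continuous).isBounded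
  have hev : ∀ᶠ t in atTop, T t '' ((⇑ι) '' K) ⊆ (⇑ι) '' K :=
    (eventually_gt_atTop tB).mono htB
  intro t ht
  apply Set.Subset.antisymm
  · rintro _ ⟨_, ⟨z, ⟨s, x, y, hx, hs, hy, hz⟩, rfl⟩, rfl⟩
    obtain ⟨w, hw, φ, hφ, hlim⟩ := exists_subseq_tendsto_omegaLimitY ι.continuous hK hev
      (tendsto_atTop_add_const_left _ t hs) hx
    refine ⟨w, hw, tendsto_nhds_unique hlim ?_⟩
    have hTz : Tendsto (fun n => T t (ι (y (φ n)))) atTop (𝓝 (T t (ι z))) :=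
      (((hTcont t ht).comp ι.continuous).tendsto z).comp (hz.comp hφ)
    refine hTz.congr' ?_
    filter_upwards [(hs.comp hφ).eventually_ge_atTop 0] with n hn
    rw [hy, hTadd (s (φ n)) hn t ht, Function.comp_apply]
  · rintro _ ⟨z, ⟨s, x, y, hx, hs, hy, hz⟩, rfl⟩
    obtain ⟨w, hw, φ, hφ, hlim⟩ := exists_subseq_tendsto_omegaLimitY ι.continuous hK hev
      (tendsto_atTop_add_const_right _ (-t) hs) hx
    refine ⟨ι w, ⟨w, hw, rfl⟩, tendsto_nhds_unique (((hTcont t ht).tendsto _).comp hlim) ?_⟩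
    refine ((ι.continuous.tendsto z).comp (hz.comp hφ)).congr' ?_
    filter_upwards [(hs.comp hφ).eventually_ge_atTop t] with n hn
    have hn' : s (φ n) + -t ≥ 0 := by simpa [← sub_eq_add_neg] using hn
    have hT := congrFun (hTadd _ hn' t ht) (x (φ n))
    rw [add_add_neg_cancel'_right] at hT
    simpa [hy] using hT
end

section
/- Under these hypotheses, the set A := ω_Y(K) attracts bounded sets of X in the Y-norm: for every bounded set B ⊆ X there exists t' > 0 such that T(t)B ⊆ ι(K) ⊆ ι(Y) for all t > t' (in particular T(t)B is bounded in Y for large t), and sup_{b ∈ B} inf_{a ∈ A} ‖ι⁻¹(T(t)b) − a‖_Y → 0 as t → ∞. -/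
open Filter Topology

/-- Under the absorption hypotheses, the set `A := ω_Y(K)` attracts bounded sets of `X` in
the `Y`-norm: for every bounded `B ⊆ X` there is `t' > 0` with `T(t)B ⊆ ι(K)` for all
`t > t'` (in particular `T(t)B` is bounded in `Y` for large `t`), and
`sup_{b ∈ B} inf_{a ∈ A} ‖ι⁻¹(T(t)b) − a‖_Y → 0` as `t → ∞`. -/
theorem omegaLimitY_attracts_in_Y
    {X Y : Type*}
    [NormedAddCommGroup X] [InnerProductSpace ℝ X] [CompleteSpace X]
    [NormedAddCommGroup Y] [InnerProductSpace ℝ Y] [CompleteSpace Y]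
    (T : ℝ → X → X)
    (hT0 : T 0 = id)
    (hTadd : ∀ s ≥ (0:ℝ), ∀ t ≥ (0:ℝ), T (t + s) = T t ∘ T s)
    (hTcont : ∀ t ≥ (0:ℝ), Continuous (T t))
    (ι : Y →L[ℝ] X) (hι : Function.Injective ι)
    (K : Set Y) (hK : IsCompact K)
    (habs : ∀ B : Set X, Bornology.IsBounded B →
      ∃ tB > (0:ℝ), ∀ t > tB, T t '' B ⊆ (⇑ι) '' K) :
    ∀ B : Set X, Bornology.IsBounded B →
      ∃ t' > (0:ℝ),
        (∀ t > t', T t '' B ⊆ (⇑ι) '' K) ∧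
        (∀ ε > (0:ℝ), ∃ t₀ : ℝ, ∀ t > t₀, ∀ b ∈ B,
          ∃ y : Y, ι y = T t b ∧
            Metric.infDist y (omegaLimitY T (⇑ι) ((⇑ι) '' K)) < ε) := by
  intro B hB
  obtain ⟨tB, htB, habsB⟩ := habs B hB
  refine ⟨tB, htB, habsB, fun ε hε => ?_⟩
  by_contra! hfar
  choose t ht b hb hy using fun n : ℕ => hfar (n + (tB + 1))
  have htn (n : ℕ) : (n : ℝ) < t n - (tB + 1) := by linarith [ht n]
  have ht' (n : ℕ) : tB < t n := by linarith [htn n, (Nat.cast_nonneg n : (0 : ℝ) ≤ n)]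
  choose y hyK hyT using fun n => habsB (t n) (ht' n) ⟨b n, hb n, rfl⟩
  obtain ⟨z, -, φ, hφ, hz⟩ := hK.tendsto_subseq hyK
  have hzω : z ∈ omegaLimitY T (⇑ι) ((⇑ι) '' K) := by
    refine ⟨fun n => t (φ n) - (tB + 1), fun n => T (tB + 1) (b (φ n)), y ∘ φ,
      fun n => habsB _ (lt_add_one tB) ⟨_, hb _, rfl⟩, ?_, fun n => ?_, hz⟩
    · exact (tendsto_atTop_mono (fun n => (htn n).le)
        tendsto_natCast_atTop_atTop).comp hφ.tendsto_atTop
    · have hadd := hTadd (tB + 1) (by linarith) (t (φ n) - (tB + 1))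
        ((Nat.cast_nonneg (φ n)).trans (htn (φ n)).le)
      rw [sub_add_cancel] at hadd
      exact (hyT (φ n)).trans (congrFun hadd _)
  obtain ⟨n, hn⟩ := (Metric.tendsto_nhds.mp hz ε hε).exists
  exact absurd ((Metric.infDist_le_dist_of_mem hzω).trans_lt hn)
    (hy (φ n) _ (hyT (φ n))).not_gt
end

section
/- The constant C := ∫₀¹ x^{n−2β} (∫ₓ¹ s^{−n} ds) dx is finite, and for every continuously differentiable function f : (0,1] → ℝ with f(1) = 0 the weighted Hardy-type inequality ∫₀¹ x^{n−2β} f(x)² dx ≤ C · ∫₀¹ s^{n} f'(s)² ds holds (both sides being allowed to equal +∞). -/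
open MeasureTheory Set

/-- Comparison of the tail integral of `s ^ (-a)` with a pure power. -/
lemma setIntegral_Ioc_rpow_neg_le {a ε x : ℝ} (ha : 1 ≤ a) (hε : 0 < ε) (hx : 0 < x)
    (hx1 : x ≤ 1) : ∫ s in Ioc x 1, s ^ (-a) ≤ x ^ (1 - a - ε) / ε := by
  have h0 : (0 : ℝ) ∉ uIcc x 1 := by
    rw [uIcc_of_le hx1]
    exact fun h => absurd h.1 (not_le.2 hx)
  have hi (r : ℝ) : IntervalIntegrable (fun s : ℝ => s ^ r) volume x 1 :=
    intervalIntegral.intervalIntegrable_rpow (Or.inr h0)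
  rw [← intervalIntegral.integral_of_le hx1]
  calc ∫ s in x..1, s ^ (-a) ≤ ∫ s in x..1, x ^ (1 - a - ε) * s ^ (ε - 1) := by
        refine intervalIntegral.integral_mono_on hx1 (hi _) ((hi _).const_mul _) fun s hs => ?_
        have hs0 : 0 < s := hx.trans_le hs.1
        calc s ^ (-a) = s ^ (1 - a - ε) * s ^ (ε - 1) := by
              rw [← Real.rpow_add hs0]; ring_nf
          _ ≤ _ := mul_le_mul_of_nonneg_right
              (Real.rpow_le_rpow_of_nonpos hx hs.1 (by linarith)) (Real.rpow_nonneg hs0.le _)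
    _ = x ^ (1 - a - ε) * ((1 - x ^ ε) / ε) := by
        rw [intervalIntegral.integral_const_mul, integral_rpow (Or.inl (by linarith))]
        simp
    _ ≤ x ^ (1 - a - ε) * (1 / ε) := by
        gcongr
        linarith [Real.rpow_nonneg hx.le ε]
    _ = _ := by ring

/-- Integrability of the tail integral of `s ^ (-a)` against the weight `x ^ (a - 2 * β)`. -/
lemma integrableOn_rpow_mul_setIntegral_rpow_neg {a β : ℝ} (ha : 1 ≤ a) (hβ : β < 1) :
    IntegrableOn (fun x : ℝ => x ^ (a - 2 * β) * ∫ s in Ioc x 1, s ^ (-a)) (Ioc (0 : ℝ) 1) := by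
  have hdom : IntegrableOn (fun x : ℝ => x ^ (-β) / (1 - β)) (Ioc (0 : ℝ) 1) := by
    rw [← intervalIntegrable_iff_integrableOn_Ioc_of_le zero_le_one]
    exact (intervalIntegral.intervalIntegrable_rpow' (by linarith)).div_const _
  have hnn (x : ℝ) (hx : 0 < x) (s : ℝ) (hs : s ∈ Ioc x 1) : 0 ≤ s ^ (-a) :=
    Real.rpow_nonneg (hx.trans hs.1).le _
  have hanti : AntitoneOn (fun x : ℝ => ∫ s in Ioc x 1, s ^ (-a)) (Ioc (0 : ℝ) 1) := by
    intro x hx y hy hxy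
    refine setIntegral_mono_set ?_ ?_ (Ioc_subset_Ioc_left hxy).eventuallyLE
    · rw [← intervalIntegrable_iff_integrableOn_Ioc_of_le hx.2]
      refine intervalIntegral.intervalIntegrable_rpow (Or.inr ?_)
      rw [uIcc_of_le hx.2]
      exact fun h => absurd h.1 (not_le.2 hx.1)
    · exact (ae_restrict_mem measurableSet_Ioc).mono (hnn x hx.1)
  refine Integrable.mono' hdom ?_ ?_
  · refine AEMeasurable.aestronglyMeasurable (AEMeasurable.mul ?_ ?_)
    · exact (measurable_id.pow_const _).aemeasurable
    · exact aemeasurable_restrict_of_antitoneOn measurableSet_Ioc hanti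
  · filter_upwards [ae_restrict_mem measurableSet_Ioc] with x hx
    have hpow : 0 ≤ x ^ (a - 2 * β) := Real.rpow_nonneg hx.1.le _
    rw [Real.norm_of_nonneg
      (mul_nonneg hpow (setIntegral_nonneg measurableSet_Ioc (hnn x hx.1)))]
    calc _ ≤ x ^ (a - 2 * β) * (x ^ (1 - a - (1 - β)) / (1 - β)) :=
          mul_le_mul_of_nonneg_left
            (setIntegral_Ioc_rpow_neg_le ha (by linarith) hx.1 hx.2) hpow
      _ = _ := by
          rw [← mul_div_assoc, ← Real.rpow_add hx.1]; ring_nf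

/-- Weighted Cauchy–Schwarz inequality for a continuous function on a compact interval. -/
lemma sq_intervalIntegral_le_mul_of_pos {w g : ℝ → ℝ} {x y : ℝ} (hxy : x < y)
    (hw : ContinuousOn w (Icc x y)) (hwpos : ∀ s ∈ Icc x y, 0 < w s)
    (hg : ContinuousOn g (Icc x y)) :
    (∫ s in x..y, g s) ^ 2 ≤ (∫ s in x..y, (w s)⁻¹) * ∫ s in x..y, w s * g s ^ 2 := by
  have hwi : ContinuousOn (fun s => (w s)⁻¹) (Icc x y) := hw.inv₀ fun s hs => (hwpos s hs).ne'
  have iw := hwi.intervalIntegrable_of_Icc (μ := volume) hxy.le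
  have ig := hg.intervalIntegrable_of_Icc (μ := volume) hxy.le
  have iwg : IntervalIntegrable (fun s => w s * g s ^ 2) volume x y :=
    (hw.mul (hg.pow 2)).intervalIntegrable_of_Icc hxy.le
  have hA : 0 < ∫ s in x..y, (w s)⁻¹ :=
    intervalIntegral.intervalIntegral_pos_of_pos_on iw
      (fun s hs => inv_pos.2 (hwpos s (Ioo_subset_Icc_self hs))) hxy
  set A := ∫ s in x..y, (w s)⁻¹
  set B := ∫ s in x..y, g s
  set D := ∫ s in x..y, w s * g s ^ 2
  have h0 : 0 ≤ ∫ s in x..y, w s * (A * g s - B * (w s)⁻¹) ^ 2 :=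
    intervalIntegral.integral_nonneg hxy.le fun s hs =>
      mul_nonneg (hwpos s hs).le (sq_nonneg _)
  have h1 : ∫ s in x..y, w s * (A * g s - B * (w s)⁻¹) ^ 2
      = ∫ s in x..y, (A ^ 2 * (w s * g s ^ 2) - 2 * A * B * g s + B ^ 2 * (w s)⁻¹) := by
    refine intervalIntegral.integral_congr fun s hs => ?_
    rw [uIcc_of_le hxy.le] at hs
    have := (hwpos s hs).ne'
    field_simp
    ring
  have h2 : ∫ s in x..y, (A ^ 2 * (w s * g s ^ 2) - 2 * A * B * g s + B ^ 2 * (w s)⁻¹)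
      = A ^ 2 * D - 2 * A * B * B + B ^ 2 * A := by
    rw [intervalIntegral.integral_add ((iwg.const_mul _).sub (ig.const_mul _)) (iw.const_mul _),
      intervalIntegral.integral_sub (iwg.const_mul _) (ig.const_mul _)]
    simp only [intervalIntegral.integral_const_mul]
    rfl
  rw [h1, h2] at h0
  have h3 : 0 ≤ A * (A * D - B ^ 2) := by linarith
  linarith [nonneg_of_mul_nonneg_right h3 hA]

/-- Pointwise bound of a function vanishing at `1` by the weighted energy of its derivative. -/
lemma ofReal_sq_le_mul_lintegral_deriv_sq {a x : ℝ} {f f' : ℝ → ℝ}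
    (hf : ∀ x ∈ Ioc (0 : ℝ) 1, HasDerivAt f (f' x) x) (hf' : ContinuousOn f' (Ioc (0 : ℝ) 1))
    (hf1 : f 1 = 0) (hx : x ∈ Ioc (0 : ℝ) 1) :
    ENNReal.ofReal (f x ^ 2) ≤ ENNReal.ofReal (∫ s in Ioc x 1, s ^ (-a))
      * ∫⁻ s in Ioc (0 : ℝ) 1, ENNReal.ofReal (s ^ a * f' s ^ 2) := by
  rcases hx.2.eq_or_lt with rfl | hx1
  · simp [hf1]
  have hsub : Icc x 1 ⊆ Ioc 0 1 := fun s hs => ⟨hx.1.trans_le hs.1, hs.2⟩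
  have hg := hf'.mono hsub
  have hw : ContinuousOn (fun s : ℝ => s ^ a) (Icc x 1) := fun s hs =>
    (Real.continuousAt_rpow_const s a (Or.inl (hsub hs).1.ne')).continuousWithinAt
  have hwpos (s : ℝ) (hs : s ∈ Icc x 1) : 0 < s ^ a := Real.rpow_pos_of_pos (hsub hs).1 a
  have hftc : ∫ s in x..1, f' s = -f x := by
    rw [intervalIntegral.integral_eq_sub_of_hasDerivAt (f := f) _
      (hg.intervalIntegrable_of_Icc hx1.le), hf1, zero_sub]
    intro s hs
    rw [uIcc_of_le hx1.le] at hs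
    exact hf s (hsub hs)
  have hcs := sq_intervalIntegral_le_mul_of_pos hx1 hw hwpos hg
  rw [hftc, neg_sq, intervalIntegral.integral_of_le hx1.le,
    intervalIntegral.integral_of_le hx1.le] at hcs
  have hinv : ∫ s in Ioc x 1, (s ^ a)⁻¹ = ∫ s in Ioc x 1, s ^ (-a) :=
    setIntegral_congr_fun measurableSet_Ioc fun s hs =>
      (Real.rpow_neg (hx.1.trans hs.1).le a).symm
  have hnn : 0 ≤ ∫ s in Ioc x 1, s ^ (-a) :=
    setIntegral_nonneg measurableSet_Ioc fun s hs => Real.rpow_nonneg (hx.1.trans hs.1).le _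
  rw [hinv] at hcs
  refine (ENNReal.ofReal_le_ofReal hcs).trans ?_
  rw [ENNReal.ofReal_mul hnn]
  gcongr
  rw [ofReal_integral_eq_lintegral_ofReal]
  · exact lintegral_mono_set (Ioc_subset_Ioc_left hx.1.le)
  · exact ((hw.mul (hg.pow 2)).integrableOn_Icc).mono_set Ioc_subset_Icc_self
  · filter_upwards [ae_restrict_mem measurableSet_Ioc] with s hs
    exact mul_nonneg (hwpos s (Ioc_subset_Icc_self hs)).le (sq_nonneg _)

/-- The constant `C := ∫₀¹ x^{n−2β} (∫ₓ¹ s^{−n} ds) dx` is finite and, for every `C¹`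
function `f : (0,1] → ℝ` with `f 1 = 0`, the weighted Hardy-type inequality
`∫₀¹ x^{n−2β} f(x)² dx ≤ C ∫₀¹ sⁿ f'(s)² ds` holds (both sides allowed to be `+∞`). -/
theorem weighted_hardy_inequality (n : ℕ) (hn : 1 ≤ n) (β : ℝ) (hβ : β < 1) :
    IntegrableOn
      (fun x : ℝ => x ^ ((n : ℝ) - 2 * β) * ∫ s in Ioc x 1, s ^ (-(n : ℝ)))
      (Ioc (0:ℝ) 1) ∧
    ∀ f f' : ℝ → ℝ,
      (∀ x ∈ Ioc (0:ℝ) 1, HasDerivAt f (f' x) x) →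
      ContinuousOn f' (Ioc (0:ℝ) 1) →
      f 1 = 0 →
      ∫⁻ x in Ioc (0:ℝ) 1, ENNReal.ofReal (x ^ ((n : ℝ) - 2 * β) * (f x) ^ 2)
        ≤ ENNReal.ofReal
            (∫ x in Ioc (0:ℝ) 1, x ^ ((n : ℝ) - 2 * β) * ∫ s in Ioc x 1, s ^ (-(n : ℝ)))
          * ∫⁻ s in Ioc (0:ℝ) 1, ENNReal.ofReal (s ^ (n : ℝ) * (f' s) ^ 2) := by
  have hint := integrableOn_rpow_mul_setIntegral_rpow_neg (a := n) (by exact_mod_cast hn) hβ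
  refine ⟨hint, fun f f' hf hf' hf1 => ?_⟩
  rw [ofReal_integral_eq_lintegral_ofReal hint,
    ← lintegral_mul_const'' _ hint.1.aemeasurable.ennreal_ofReal]
  · refine setLIntegral_mono' measurableSet_Ioc fun x hx => ?_
    have hpow : 0 ≤ x ^ ((n : ℝ) - 2 * β) := Real.rpow_nonneg hx.1.le _
    rw [ENNReal.ofReal_mul hpow, ENNReal.ofReal_mul hpow, mul_assoc]
    gcongr
    exact ofReal_sq_le_mul_lintegral_deriv_sq hf hf' hf1 hx
  · filter_upwards [ae_restrict_mem measurableSet_Ioc] with x hx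
    exact mul_nonneg (Real.rpow_nonneg hx.1.le _) (setIntegral_nonneg measurableSet_Ioc
      fun s hs => Real.rpow_nonneg (hx.1.trans hs.1).le _)
end
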